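/- arXiv:2107.00966 — 7 statements merged into one kernel-verified Lean document; each statement's English description precedes it below -/
import Mathlib

section
/- Let {u_k^d, y_k^d}_{k=0}^{N-1} be a trajectory of the LTI system and let 1 ≤ L ≤ N. For any α ∈ ℝ^{N−L+1}, the sequence {ū_k, ȳ_k}_{k=0}^{L-1} defined (in stacked form) by ū = H_L(u^d)α and ȳ = H_L(y^d)α is a trajectory of the LTI system. -/
open Matrix

noncomputable section

/-- Hankel matrix of depth `L` of the sequence `u : {0,…,N-1} → ℝ^m`:
the block in block-row `i` and column `j` is `u (i+j)`. -/
def Hankel (m N L : ℕ) (u : ℕ → Fin m → ℝ) :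
    Matrix (Fin L × Fin m) (Fin (N - L + 1)) ℝ :=
  Matrix.of fun ik j => u ((ik.1 : ℕ) + (j : ℕ)) ik.2

/-- The sequence `u` (of length `N`) is persistently exciting of order `L`. -/
def PersistentlyExciting (m N L : ℕ) (u : ℕ → Fin m → ℝ) : Prop :=
  (Hankel m N L u).rank = m * L

/-- `{u_k, y_k}_{k=0}^{L-1}` is a trajectory of the LTI system `(A,B,C,D)`. -/
def IsTrajectory (n m p L : ℕ) (A : Matrix (Fin n) (Fin n) ℝ)
    (B : Matrix (Fin n) (Fin m) ℝ) (C : Matrix (Fin p) (Fin n) ℝ)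
    (D : Matrix (Fin p) (Fin m) ℝ) (u : ℕ → Fin m → ℝ) (y : ℕ → Fin p → ℝ) : Prop :=
  ∃ x : ℕ → Fin n → ℝ, ∀ k < L,
    x (k + 1) = A.mulVec (x k) + B.mulVec (u k) ∧
    y k = C.mulVec (x k) + D.mulVec (u k)

/-- `(A,B)` is controllable: `rank [B, AB, …, A^{n-1}B] = n`. -/
def Controllable (n m : ℕ) (A : Matrix (Fin n) (Fin n) ℝ)
    (B : Matrix (Fin n) (Fin m) ℝ) : Prop :=
  (Matrix.of fun i (kj : Fin n × Fin m) => ((A ^ (kj.1 : ℕ)) * B) i kj.2).rank = n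

/-- `(A,C)` is observable: `rank [C; CA; …; CA^{n-1}] = n`. -/
def Observable (n p : ℕ) (A : Matrix (Fin n) (Fin n) ℝ)
    (C : Matrix (Fin p) (Fin n) ℝ) : Prop :=
  (Matrix.of fun (ki : Fin n × Fin p) j => (C * A ^ (ki.1 : ℕ)) ki.2 j).rank = n

/-- A block of the product of a Hankel matrix with a vector is the corresponding linear
combination of shifts of the sequence. -/
lemma eq_sum_smul_of_Hankel_mulVec (m N L : ℕ) (u ub : ℕ → Fin m → ℝ) (α : Fin (N - L + 1) → ℝ)
    (h : ∀ (k : Fin L) (a : Fin m), ub k a = (Hankel m N L u).mulVec α (k, a))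
    {k : ℕ} (hk : k < L) : ub k = ∑ j, α j • u (k + j) := by
  ext a
  simpa [Hankel, Matrix.mulVec, dotProduct, mul_comm] using h ⟨k, hk⟩ a

/-- Any linear combination of the columns of the stacked Hankel matrices of a measured
trajectory is again a trajectory of the LTI system. -/
theorem hankel_combination_isTrajectory (n m p N L : ℕ)
    (A : Matrix (Fin n) (Fin n) ℝ) (B : Matrix (Fin n) (Fin m) ℝ)
    (C : Matrix (Fin p) (Fin n) ℝ) (D : Matrix (Fin p) (Fin m) ℝ)
    (ud : ℕ → Fin m → ℝ) (yd : ℕ → Fin p → ℝ)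
    (hT : IsTrajectory n m p N A B C D ud yd)
    (hL1 : 1 ≤ L) (hLN : L ≤ N)
    (α : Fin (N - L + 1) → ℝ)
    (ub : ℕ → Fin m → ℝ) (yb : ℕ → Fin p → ℝ)
    (hub : ∀ (k : Fin L) (a : Fin m), ub k a = (Hankel m N L ud).mulVec α (k, a))
    (hyb : ∀ (k : Fin L) (b : Fin p), yb k b = (Hankel p N L yd).mulVec α (k, b)) :
    IsTrajectory n m p L A B C D ub yb := by
  obtain ⟨x, hx⟩ := hT
  refine ⟨fun k => ∑ j, α j • x (k + j), fun k hk => ?_⟩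
  have hstep (j : Fin (N - L + 1)) := hx (k + j) (by omega)
  rw [eq_sum_smul_of_Hankel_mulVec m N L ud ub α hub hk, eq_sum_smul_of_Hankel_mulVec p N L yd yb α hyb hk]
  simp only [Matrix.mulVec_sum, Matrix.mulVec_smul, ← Finset.sum_add_distrib, ← smul_add]
  refine ⟨Finset.sum_congr rfl fun j _ => ?_, Finset.sum_congr rfl fun j _ => ?_⟩
  · rw [← (hstep j).1, Nat.add_right_comm]
  · rw [← (hstep j).2]
end
end

section
/- Suppose (A,B) is controllable, {u_k^d, y_k^d}_{k=0}^{N-1} is a trajectory of the LTI system, and u^d is persistently exciting of order L + n. Then every trajectory {ū_k, ȳ_k}_{k=0}^{L-1} of the LTI system can be written (in stacked form) as ū = H_L(u^d)α and ȳ = H_L(y^d)α for some α ∈ ℝ^{N−L+1}. -/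
open Matrix

noncomputable section

/-- A matrix whose rank is its number of rows has trivial left kernel. -/
theorem eq_zero_of_vecMul_eq_zero_of_rank {ι κ : Type*} [Fintype ι] [Fintype κ]
    {M : Matrix ι κ ℝ} (hM : M.rank = Fintype.card ι) {v : ι → ℝ} (hv : v ᵥ* M = 0) :
    v = 0 := by
  have hli : LinearIndependent ℝ M.row := by
    rw [linearIndependent_iff_card_eq_finrank_span, ← hM, M.rank_eq_finrank_span_row]
    rfl
  exact Matrix.vecMul_injective_iff.2 hli (by simpa using hv)

/-- A matrix with trivial left kernel acts surjectively on column vectors. -/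
theorem mulVec_surjective_of_vecMul_eq_zero {ι κ : Type*} [Fintype ι] [Fintype κ]
    {M : Matrix ι κ ℝ} (hM : ∀ v, v ᵥ* M = 0 → v = 0) :
    Function.Surjective M.mulVec := by
  have hinj : Function.Injective fun v => v ᵥ* M := fun v w hvw =>
    sub_eq_zero.1 (hM _ (by rw [Matrix.sub_vecMul]; exact sub_eq_zero.2 hvw))
  have hrank := (Matrix.vecMul_injective_iff.1 hinj).rank_matrix
  have htop : LinearMap.range M.mulVecLin = ⊤ :=
    Submodule.eq_top_of_finrank_eq (by simpa [Matrix.rank] using hrank)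
  exact LinearMap.range_eq_top.1 htop

/-- The coefficients, in reversed time order, of the inputs in the relation obtained by
shifting `ξ ⬝ᵥ x j + ∑ i < L, η i ⬝ᵥ u (j + i) = 0` forward along the system dynamics. -/
def annihilatorCoeff {n m : ℕ} (A : Matrix (Fin n) (Fin n) ℝ) (B : Matrix (Fin n) (Fin m) ℝ)
    (L : ℕ) (ξ : Fin n → ℝ) (η : ℕ → Fin m → ℝ) (r : ℕ) : Fin m → ℝ :=
  if r < L then η (L - 1 - r) else ξ ᵥ* (A ^ (r - L) * B)

theorem shifted_annihilator {n m N L : ℕ} {A : Matrix (Fin n) (Fin n) ℝ}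
    {B : Matrix (Fin n) (Fin m) ℝ} {u : ℕ → Fin m → ℝ} {x : ℕ → Fin n → ℝ}
    (hL : 1 ≤ L) (hx : ∀ k < N, x (k + 1) = A *ᵥ x k + B *ᵥ u k)
    {ξ : Fin n → ℝ} {η : ℕ → Fin m → ℝ}
    (h : ∀ j, j + L ≤ N → ξ ⬝ᵥ x j + ∑ i ∈ Finset.range L, η i ⬝ᵥ u (j + i) = 0) (s : ℕ) :
    ∀ j, j + L + s ≤ N → (ξ ᵥ* A ^ s) ⬝ᵥ x j +
      ∑ q ∈ Finset.range (L + s), annihilatorCoeff A B L ξ η (L + s - 1 - q) ⬝ᵥ u (j + q) = 0 := by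
  induction s with
  | zero =>
    intro j hj
    rw [← h j hj, pow_zero, Matrix.vecMul_one, add_zero]
    congr 1
    refine Finset.sum_congr rfl fun q hq => ?_
    have hq := Finset.mem_range.1 hq
    rw [annihilatorCoeff, if_pos (by omega), show L - 1 - (L - 1 - q) = q by omega]
  | succ s ih =>
    intro j hj
    rw [← ih (j + 1) (by omega), hx j (by omega), ← add_assoc L s 1, Finset.sum_range_succ',
      dotProduct_add, Matrix.dotProduct_mulVec, Matrix.dotProduct_mulVec,
      Matrix.vecMul_vecMul, Matrix.vecMul_vecMul, ← pow_succ]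
    have h0 : annihilatorCoeff A B L ξ η (L + s + 1 - 1 - 0) = ξ ᵥ* (A ^ s * B) := by
      rw [annihilatorCoeff, if_neg (by omega), show L + s + 1 - 1 - 0 - L = s by omega]
    have hs : ∀ q, annihilatorCoeff A B L ξ η (L + s + 1 - 1 - (q + 1)) ⬝ᵥ u (j + (q + 1)) =
        annihilatorCoeff A B L ξ η (L + s - 1 - q) ⬝ᵥ u (j + 1 + q) := fun q => by
      rw [show L + s + 1 - 1 - (q + 1) = L + s - 1 - q by omega,
        show j + (q + 1) = j + 1 + q by omega]
    simp only [h0, hs, add_zero]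
    ring

/-- A sequence annihilated by a monic recurrence, with zero initial conditions, vanishes. -/
theorem eq_zero_of_monic_recurrence {V : Type*} [AddCommGroup V] [Module ℝ V] {n K : ℕ}
    {c : ℕ → ℝ} (hc : c n = 1) {h : ℕ → V}
    (hrec : ∀ r < K, ∑ s ∈ Finset.range (n + 1),
      (if n ≤ r + s then c s • h (r + s - n) else 0) = 0) :
    ∀ r < K, h r = 0 := by
  intro r
  induction r using Nat.strong_induction_on with
  | _ r ih =>
    intro hr
    have key := hrec r hr
    rw [Finset.sum_range_succ, Finset.sum_eq_zero, zero_add, if_pos (by omega), hc, one_smul,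
      Nat.add_sub_cancel] at key
    · exact key
    · intro s hs
      have hs := Finset.mem_range.1 hs
      split_ifs with hrs
      · rw [ih _ (by omega) (by omega), smul_zero]
      · rfl

theorem PersistentlyExciting.eq_zero {m N K : ℕ} {u : ℕ → Fin m → ℝ}
    (hu : PersistentlyExciting m N K u) (hK : K ≤ N) {w : ℕ → Fin m → ℝ}
    (hw : ∀ j, j + K ≤ N → ∑ q ∈ Finset.range K, w q ⬝ᵥ u (j + q) = 0) :
    ∀ q < K, w q = 0 := by
  have hv := eq_zero_of_vecMul_eq_zero_of_rank (M := Hankel m N K u)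
    (v := fun ik => w ik.1 ik.2) (by rw [hu]; simp [mul_comm]) (by
      ext j
      rw [Pi.zero_apply, ← hw j (by omega), Finset.sum_range]
      simp only [Matrix.vecMul, dotProduct, Fintype.sum_prod_type, Hankel, Matrix.of_apply,
        add_comm])
  intro q hq
  ext a
  exact congrFun hv (⟨q, hq⟩, a)

theorem Controllable.eq_zero {n m : ℕ} {A : Matrix (Fin n) (Fin n) ℝ}
    {B : Matrix (Fin n) (Fin m) ℝ} (hAB : Controllable n m A B) {ξ : Fin n → ℝ}
    (hξ : ∀ k < n, ξ ᵥ* (A ^ k * B) = 0) : ξ = 0 :=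
  eq_zero_of_vecMul_eq_zero_of_rank (hAB.trans (Fintype.card_fin n).symm) (by
    ext ⟨k, a⟩
    exact congrFun (hξ k k.2) a)

/-- The Willems rank condition: no nontrivial linear relation holds between the states and the
length-`L` input windows of a controllable system with sufficiently exciting input. -/
theorem eq_zero_of_annihilator {n m N L : ℕ} {A : Matrix (Fin n) (Fin n) ℝ}
    {B : Matrix (Fin n) (Fin m) ℝ} {u : ℕ → Fin m → ℝ} {x : ℕ → Fin n → ℝ}
    (hAB : Controllable n m A B) (hL : 1 ≤ L) (hLN : L + n ≤ N)
    (hu : PersistentlyExciting m N (L + n) u)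
    (hx : ∀ k < N, x (k + 1) = A *ᵥ x k + B *ᵥ u k)
    {ξ : Fin n → ℝ} {η : ℕ → Fin m → ℝ}
    (h : ∀ j, j + L ≤ N → ξ ⬝ᵥ x j + ∑ i ∈ Finset.range L, η i ⬝ᵥ u (j + i) = 0) :
    ξ = 0 ∧ ∀ i < L, η i = 0 := by
  set c := A.charpoly.coeff
  set g := annihilatorCoeff A B L ξ η with hg
  have hdeg : A.charpoly.natDegree = n := by simp [Matrix.charpoly_natDegree_eq_dim]
  have hcn : c n = 1 := by
    have := A.charpoly_monic.coeff_natDegree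
    rwa [hdeg] at this
  have hCH : ∑ s ∈ Finset.range (n + 1), c s • A ^ s = 0 := by
    rw [← A.aeval_self_charpoly, Polynomial.aeval_eq_sum_range, hdeg]
  have hw := hu.eq_zero hLN (w := fun q => ∑ s ∈ Finset.range (n + 1),
    if q < L + s then c s • g (L + s - 1 - q) else 0) (by
      intro j hj
      have hstate : ∑ s ∈ Finset.range (n + 1), c s * ((ξ ᵥ* A ^ s) ⬝ᵥ x j) = 0 := by
        have := congrArg (fun M => (ξ ᵥ* M) ⬝ᵥ x j) hCH
        simpa [Matrix.vecMul_sum, Matrix.vecMul_smul, sum_dotProduct, smul_dotProduct] using this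
      have hsum : ∑ s ∈ Finset.range (n + 1), c s * ((ξ ᵥ* A ^ s) ⬝ᵥ x j +
          ∑ q ∈ Finset.range (L + s), g (L + s - 1 - q) ⬝ᵥ u (j + q)) = 0 :=
        Finset.sum_eq_zero fun s hs => by
          have hs := Finset.mem_range.1 hs
          rw [shifted_annihilator hL hx h s j (by omega), mul_zero]
      simp only [mul_add, Finset.sum_add_distrib, hstate, zero_add] at hsum
      simp only [sum_dotProduct]
      rw [Finset.sum_comm, ← hsum]
      refine Finset.sum_congr rfl fun s hs => ?_
      have hs := Finset.mem_range.1 hs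
      rw [Finset.mul_sum]
      symm
      refine Finset.sum_subset_zero_on_sdiff (Finset.range_mono (by omega)) ?_ ?_
      · intro q hq
        rw [if_neg (by simpa using (Finset.mem_sdiff.1 hq).2), zero_dotProduct]
      · intro q hq
        rw [if_pos (Finset.mem_range.1 hq), smul_dotProduct, smul_eq_mul])
  have hgz : ∀ r < L + n, g r = 0 := by
    refine eq_zero_of_monic_recurrence hcn fun r hr => ?_
    refine Eq.trans (Finset.sum_congr rfl fun s hs => ?_) (hw (L + n - 1 - r) (by omega))
    have hs := Finset.mem_range.1 hs
    rw [show L + s - 1 - (L + n - 1 - r) = r + s - n by omega]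
    exact if_congr (by omega) rfl rfl
  constructor
  · refine hAB.eq_zero fun k hk => ?_
    have := hgz (L + k) (by omega)
    rwa [hg, annihilatorCoeff, if_neg (by omega), Nat.add_sub_cancel_left] at this
  · intro i hi
    have := hgz (L - 1 - i) (by omega)
    rwa [hg, annihilatorCoeff, if_pos (by omega), show L - 1 - (L - 1 - i) = i by omega] at this

theorem Hankel_mulVec {m N L : ℕ} (u : ℕ → Fin m → ℝ) (α : Fin (N - L + 1) → ℝ)
    (k : Fin L) (a : Fin m) :
    (Hankel m N L u *ᵥ α) (k, a) = (∑ j, α j • u (k + j)) a := by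
  simp [Hankel, Matrix.mulVec, dotProduct, mul_comm]

/-- Under controllability and persistence of excitation of order `L + n`, every
trajectory of length `L` can be written as a linear combination of the columns of the
stacked Hankel matrices of the measured data. -/
theorem trajectory_eq_hankel_combination (n m p N L : ℕ)
    (A : Matrix (Fin n) (Fin n) ℝ) (B : Matrix (Fin n) (Fin m) ℝ)
    (C : Matrix (Fin p) (Fin n) ℝ) (D : Matrix (Fin p) (Fin m) ℝ)
    (hctrb : Controllable n m A B)
    (ud : ℕ → Fin m → ℝ) (yd : ℕ → Fin p → ℝ)
    (hT : IsTrajectory n m p N A B C D ud yd)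
    (hL1 : 1 ≤ L) (hLN : L + n ≤ N)
    (hPE : PersistentlyExciting m N (L + n) ud) :
    ∀ (ub : ℕ → Fin m → ℝ) (yb : ℕ → Fin p → ℝ),
      IsTrajectory n m p L A B C D ub yb →
      ∃ α : Fin (N - L + 1) → ℝ,
        (∀ (k : Fin L) (a : Fin m), ub k a = (Hankel m N L ud).mulVec α (k, a)) ∧
        (∀ (k : Fin L) (b : Fin p), yb k b = (Hankel p N L yd).mulVec α (k, b)) := by
  rintro ub yb ⟨xb, hxb⟩
  obtain ⟨x, hx⟩ := hT
  obtain ⟨α, hα⟩ := mulVec_surjective_of_vecMul_eq_zero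
    (M := Matrix.fromRows (Matrix.of fun i (j : Fin (N - L + 1)) => x j i) (Hankel m N L ud))
    (fun v hv => by
      have hann := eq_zero_of_annihilator hctrb hL1 hLN hPE (fun k hk => (hx k hk).1)
        (ξ := fun i => v (.inl i))
        (η := fun i a => if hi : i < L then v (.inr (⟨i, hi⟩, a)) else 0) (by
          intro j hj
          have := congrFun hv ⟨j, by omega⟩
          rw [Pi.zero_apply] at this
          rw [← this, Finset.sum_range]
          simp [Matrix.vecMul, dotProduct, Fintype.sum_prod_type, Hankel, add_comm])
      ext (i | ⟨k, a⟩)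
      · exact congrFun hann.1 i
      · simpa using congrFun (hann.2 k k.2) a)
    (Sum.elim (xb 0) fun ka => ub ka.1 ka.2)
  rw [Matrix.fromRows_mulVec, Sum.elim_eq_iff] at hα
  have hub : ∀ k < L, ub k = ∑ j, α j • ud (k + j) := fun k hk => by
    ext a
    rw [← Hankel_mulVec ud α ⟨k, hk⟩ a, hα.2]
  have hstate : ∀ k < L, xb k = ∑ j, α j • x (k + j) := by
    intro k
    induction k with
    | zero =>
      intro _
      rw [← hα.1]
      ext i
      simp [Matrix.mulVec, dotProduct, mul_comm]
    | succ k ih =>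
      intro hk
      rw [(hxb k (by omega)).1, ih (by omega), hub k (by omega), Matrix.mulVec_sum,
        Matrix.mulVec_sum, ← Finset.sum_add_distrib]
      refine Finset.sum_congr rfl fun j _ => ?_
      rw [Matrix.mulVec_smul, Matrix.mulVec_smul, ← smul_add, ← (hx (k + j) (by omega)).1,
        Nat.add_right_comm]
  refine ⟨α, fun k a => by rw [hub k k.2, Hankel_mulVec], fun k b => ?_⟩
  rw [Hankel_mulVec, (hxb k k.2).2, hstate k k.2, hub k k.2, Matrix.mulVec_sum,
    Matrix.mulVec_sum, ← Finset.sum_add_distrib]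
  refine congrFun (Finset.sum_congr rfl fun j _ => ?_) b
  rw [Matrix.mulVec_smul, Matrix.mulVec_smul, ← smul_add, ← (hx (k + j) (by omega)).2]
end
end

section
/- Suppose (A,B) is controllable, {u_k^d}_{k=0}^{N-1} is an input sequence that is persistently exciting of order L + n, and {x_k^d}_{k=0}^{N} is a corresponding state sequence satisfying x_{k+1}^d = A x_k^d + B u_k^d. Then the (mL + n) × (N − L + 1) matrix obtained by stacking H_L(u^d) on top of the matrix X = [x_0^d, x_1^d, …, x_{N−L}^d] has full row rank mL + n. -/
open Matrix

noncomputable section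

/-- The matrix `[H_L(u); x_0 x_1 … x_{N-L}]` stacking the input Hankel matrix on top of
the corresponding states. -/
def HankelState (n m N L : ℕ) (u : ℕ → Fin m → ℝ) (x : ℕ → Fin n → ℝ) :
    Matrix ((Fin L × Fin m) ⊕ Fin n) (Fin (N - L + 1)) ℝ :=
  Matrix.of fun i j =>
    match i with
    | Sum.inl ka => u ((ka.1 : ℕ) + (j : ℕ)) ka.2
    | Sum.inr s => x (j : ℕ) s

theorem rank_eq_card_iff_vecMul_eq_zero {K ι κ : Type*} [Field K] [Fintype ι] [Fintype κ]
    (M : Matrix ι κ K) :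
    M.rank = Fintype.card ι ↔ ∀ v : ι → K, v ᵥ* M = 0 → v = 0 := by
  have h_rows : M.rank = Fintype.card ι ↔ LinearIndependent K M.row := by
    rw [M.rank_eq_finrank_span_row, linearIndependent_iff_card_eq_finrank_span, Set.finrank,
      eq_comm]
  rw [h_rows, ← Matrix.vecMul_injective_iff]
  exact injective_iff_map_eq_zero M.vecMulLinear

/-- The variation-of-constants formula, tested against a covector `ξ`. -/
theorem dotProduct_state_add {n m N : ℕ} {A : Matrix (Fin n) (Fin n) ℝ}
    {B : Matrix (Fin n) (Fin m) ℝ} {u : ℕ → Fin m → ℝ} {x : ℕ → Fin n → ℝ}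
    (hx : ∀ k < N, x (k + 1) = A.mulVec (x k) + B.mulVec (u k))
    (ξ : Fin n → ℝ) (j s : ℕ) (hjs : j + s ≤ N) :
    ξ ⬝ᵥ x (j + s) = (ξ ᵥ* A ^ s) ⬝ᵥ x j +
      ∑ t ∈ Finset.range s, (ξ ᵥ* (A ^ (s - 1 - t) * B)) ⬝ᵥ u (j + t) := by
  induction s generalizing ξ with
  | zero => simp
  | succ s ih =>
    rw [← add_assoc, hx (j + s) (by omega), dotProduct_add, dotProduct_mulVec,
      dotProduct_mulVec, ih (ξ ᵥ* A) (by omega), Finset.sum_range_succ, vecMul_vecMul,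
      ← pow_succ', ← add_assoc]
    congr 2
    · refine Finset.sum_congr rfl fun t ht => ?_
      have ht := Finset.mem_range.mp ht
      rw [vecMul_vecMul, ← Matrix.mul_assoc, ← pow_succ',
        show s - 1 - t + 1 = s + 1 - 1 - t by omega]
    · simp

/-- The covectors `ξ A^{n-1} B, …, ξ A B, ξ B, η_0, …, η_{L-1}`, continued by zero. -/
def annihilatorSeq {n m L : ℕ} (A : Matrix (Fin n) (Fin n) ℝ) (B : Matrix (Fin n) (Fin m) ℝ)
    (ξ : Fin n → ℝ) (η : Fin L → Fin m → ℝ) (k : ℕ) : Fin m → ℝ :=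
  if k < n then ξ ᵥ* (A ^ (n - 1 - k) * B)
  else if h : k - n < L then η ⟨k - n, h⟩ else 0

theorem annihilatorSeq_of_lt {n m L : ℕ} (A : Matrix (Fin n) (Fin n) ℝ)
    (B : Matrix (Fin n) (Fin m) ℝ) (ξ : Fin n → ℝ) (η : Fin L → Fin m → ℝ) {k : ℕ}
    (hk : k < n) : annihilatorSeq A B ξ η k = ξ ᵥ* (A ^ (n - 1 - k) * B) :=
  if_pos hk

theorem annihilatorSeq_add {n m L : ℕ} (A : Matrix (Fin n) (Fin n) ℝ)
    (B : Matrix (Fin n) (Fin m) ℝ) (ξ : Fin n → ℝ) (η : Fin L → Fin m → ℝ) (i : Fin L) :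
    annihilatorSeq A B ξ η (n + i) = η i := by
  simp [annihilatorSeq]

theorem annihilatorSeq_of_le {n m L : ℕ} (A : Matrix (Fin n) (Fin n) ℝ)
    (B : Matrix (Fin n) (Fin m) ℝ) (ξ : Fin n → ℝ) (η : Fin L → Fin m → ℝ) {k : ℕ}
    (hk : L + n ≤ k) : annihilatorSeq A B ξ η k = 0 := by
  rw [annihilatorSeq, if_neg (by omega), dif_neg (by omega)]

/-- A relation between inputs and state at time `j + s`, rewritten in terms of the state at
time `j`. -/
theorem sum_annihilatorSeq_shift {n m N L : ℕ} {A : Matrix (Fin n) (Fin n) ℝ}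
    {B : Matrix (Fin n) (Fin m) ℝ} {u : ℕ → Fin m → ℝ} {x : ℕ → Fin n → ℝ}
    (hx : ∀ k < N, x (k + 1) = A.mulVec (x k) + B.mulVec (u k))
    (ξ : Fin n → ℝ) (η : Fin L → Fin m → ℝ) {j s : ℕ} (hs : s ≤ n) (hjs : j + s ≤ N)
    (hrel : ∑ i : Fin L, η i ⬝ᵥ u (i + (j + s)) + ξ ⬝ᵥ x (j + s) = 0) :
    (ξ ᵥ* A ^ s) ⬝ᵥ x j +
      ∑ r ∈ Finset.range (L + n), annihilatorSeq A B ξ η (r + n - s) ⬝ᵥ u (j + r) = 0 := by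
  have h_past : ∑ r ∈ Finset.range s, annihilatorSeq A B ξ η (r + n - s) ⬝ᵥ u (j + r) =
      ∑ t ∈ Finset.range s, (ξ ᵥ* (A ^ (s - 1 - t) * B)) ⬝ᵥ u (j + t) := by
    refine Finset.sum_congr rfl fun t ht => ?_
    have ht := Finset.mem_range.mp ht
    rw [annihilatorSeq_of_lt _ _ _ _ (by omega),
      show n - 1 - (t + n - s) = s - 1 - t by omega]
  have h_window : ∑ r ∈ Finset.range L,
      annihilatorSeq A B ξ η (s + r + n - s) ⬝ᵥ u (j + (s + r)) =
      ∑ i : Fin L, η i ⬝ᵥ u (i + (j + s)) := by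
    rw [Finset.sum_range]
    refine Finset.sum_congr rfl fun i _ => ?_
    rw [show s + (i : ℕ) + n - s = n + i by omega, annihilatorSeq_add,
      show j + (s + (i : ℕ)) = i + (j + s) by omega]
  have h_tail : ∑ r ∈ Finset.range (n - s),
      annihilatorSeq A B ξ η (s + L + r + n - s) ⬝ᵥ u (j + (s + L + r)) = 0 := by
    refine Finset.sum_eq_zero fun r _ => ?_
    rw [annihilatorSeq_of_le _ _ _ _ (by omega), zero_dotProduct]
  rw [show L + n = s + L + (n - s) by omega, Finset.sum_range_add, Finset.sum_range_add,
    h_past, h_window, h_tail]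
  rw [dotProduct_state_add hx ξ j s hjs] at hrel
  linarith

/-- Persistency of excitation: the inputs satisfy no nontrivial linear relation. -/
theorem PersistentlyExciting.eq_zero_of_sum_eq_zero {m N K : ℕ} {u : ℕ → Fin m → ℝ}
    (hPE : PersistentlyExciting m N K u) {w : ℕ → Fin m → ℝ}
    (hw : ∀ j ≤ N - K, ∑ r ∈ Finset.range K, w r ⬝ᵥ u (j + r) = 0) {r : ℕ} (hr : r < K) :
    w r = 0 := by
  have h_card : (Hankel m N K u).rank = Fintype.card (Fin K × Fin m) := by
    rw [show (Hankel m N K u).rank = m * K from hPE]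
    simp [mul_comm]
  have h_zero := (rank_eq_card_iff_vecMul_eq_zero _).mp h_card
    (fun ik => w ik.1 ik.2) <| by
      funext j
      have hj := hw j (by omega)
      rw [Finset.sum_range] at hj
      simpa [vecMul, dotProduct, Hankel, Fintype.sum_prod_type, add_comm] using hj
  funext a
  exact congrFun h_zero (⟨r, hr⟩, a)

/-- A sequence that vanishes eventually and satisfies a linear recurrence with leading
coefficient one vanishes identically. -/
theorem eq_zero_of_recurrence {R V : Type*} [Semiring R] [AddCommMonoid V] [Module R V]
    {n K : ℕ} {c : ℕ → R} {v : ℕ → V} (hc : c n = 1)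
    (hrec : ∀ r < K, ∑ s ∈ Finset.range (n + 1), c s • v (r + n - s) = 0)
    (hv : ∀ k, K ≤ k → v k = 0) (k : ℕ) : v k = 0 := by
  induction hd : K - k using Nat.strong_induction_on generalizing k with
  | _ d ih =>
    by_cases hk : K ≤ k
    · exact hv k hk
    have h_lower : ∑ s ∈ Finset.range n, c s • v (k + n - s) = 0 := by
      refine Finset.sum_eq_zero fun s hs => ?_
      have hs := Finset.mem_range.mp hs
      rw [ih (K - (k + n - s)) (by omega) _ rfl, smul_zero]
    simpa [Finset.sum_range_succ, h_lower, hc] using hrec k (by omega)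

theorem Controllable.eq_zero_of_vecMul_eq_zero {n m : ℕ} {A : Matrix (Fin n) (Fin n) ℝ}
    {B : Matrix (Fin n) (Fin m) ℝ} (hctrb : Controllable n m A B) {ξ : Fin n → ℝ}
    (hξ : ∀ k < n, ξ ᵥ* (A ^ k * B) = 0) : ξ = 0 := by
  refine (rank_eq_card_iff_vecMul_eq_zero _).mp (hctrb.trans (Fintype.card_fin n).symm) ξ ?_
  funext kj
  exact congrFun (hξ kj.1 kj.1.isLt) kj.2

theorem annihilatorSeq_eq_zero {n m N L : ℕ} {A : Matrix (Fin n) (Fin n) ℝ}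
    {B : Matrix (Fin n) (Fin m) ℝ} {u : ℕ → Fin m → ℝ} {x : ℕ → Fin n → ℝ}
    (hLN : L + n ≤ N) (hPE : PersistentlyExciting m N (L + n) u)
    (hx : ∀ k < N, x (k + 1) = A.mulVec (x k) + B.mulVec (u k))
    {ξ : Fin n → ℝ} {η : Fin L → Fin m → ℝ}
    (hrel : ∀ j ≤ N - L, ∑ i : Fin L, η i ⬝ᵥ u (i + j) + ξ ⬝ᵥ x j = 0) (k : ℕ) :
    annihilatorSeq A B ξ η k = 0 := by
  have h_cayley : ∑ s ∈ Finset.range (n + 1), A.charpoly.coeff s • A ^ s = 0 := by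
    have h := A.aeval_self_charpoly
    rwa [Polynomial.aeval_eq_sum_range, charpoly_natDegree_eq_dim, Fintype.card_fin] at h
  have h_lead : A.charpoly.coeff n = 1 := by
    simpa [Polynomial.Monic, Polynomial.leadingCoeff] using A.charpoly_monic
  refine eq_zero_of_recurrence h_lead (fun r hr => ?_)
    (fun k hk => annihilatorSeq_of_le A B ξ η hk) k
  refine hPE.eq_zero_of_sum_eq_zero (w := fun r =>
    ∑ s ∈ Finset.range (n + 1), A.charpoly.coeff s • annihilatorSeq A B ξ η (r + n - s))
    (fun j hj => ?_) hr
  have h_state : ∑ s ∈ Finset.range (n + 1),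
      A.charpoly.coeff s * ((ξ ᵥ* A ^ s) ⬝ᵥ x j) = 0 := by
    have h := congrArg (fun M => ξ ⬝ᵥ (M *ᵥ x j)) h_cayley
    simpa [sum_mulVec, dotProduct_sum, smul_mulVec, dotProduct_mulVec] using h
  have h_shift : ∑ s ∈ Finset.range (n + 1), A.charpoly.coeff s * ((ξ ᵥ* A ^ s) ⬝ᵥ x j +
      ∑ r ∈ Finset.range (L + n), annihilatorSeq A B ξ η (r + n - s) ⬝ᵥ u (j + r)) = 0 := by
    refine Finset.sum_eq_zero fun s hs => ?_
    have hs := Finset.mem_range.mp hs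
    rw [sum_annihilatorSeq_shift hx ξ η (by omega) (by omega) (hrel (j + s) (by omega)),
      mul_zero]
  simp only [mul_add, Finset.sum_add_distrib, h_state, zero_add, Finset.mul_sum] at h_shift
  rw [Finset.sum_comm] at h_shift
  simpa only [sum_dotProduct, smul_dotProduct, smul_eq_mul] using h_shift

/-- If `(A,B)` is controllable and `u` is persistently exciting of order `L + n`, then
the matrix obtained by stacking `H_L(u)` on top of the state sequence matrix has full
row rank `mL + n`. -/
theorem hankel_state_full_rank (n m N L : ℕ)
    (A : Matrix (Fin n) (Fin n) ℝ) (B : Matrix (Fin n) (Fin m) ℝ)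
    (hctrb : Controllable n m A B)
    (u : ℕ → Fin m → ℝ) (x : ℕ → Fin n → ℝ)
    (hL1 : 1 ≤ L) (hLN : L + n ≤ N)
    (hPE : PersistentlyExciting m N (L + n) u)
    (hx : ∀ k < N, x (k + 1) = A.mulVec (x k) + B.mulVec (u k)) :
    (HankelState n m N L u x).rank = m * L + n := by
  have h_card : Fintype.card ((Fin L × Fin m) ⊕ Fin n) = m * L + n := by simp [mul_comm]
  rw [← h_card, rank_eq_card_iff_vecMul_eq_zero]
  intro v hv
  let η : Fin L → Fin m → ℝ := fun i a => v (Sum.inl (i, a))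
  let ξ : Fin n → ℝ := fun s => v (Sum.inr s)
  have h_zero : ∀ k, annihilatorSeq A B ξ η k = 0 := by
    refine annihilatorSeq_eq_zero hLN hPE hx fun j hj => ?_
    have h := congrFun hv ⟨j, by omega⟩
    simpa [vecMul, dotProduct, HankelState, Fintype.sum_prod_type, η, ξ] using h
  have hξ : ξ = 0 := hctrb.eq_zero_of_vecMul_eq_zero fun k hk => by
    have h := h_zero (n - 1 - k)
    rwa [annihilatorSeq_of_lt _ _ _ _ (by omega),
      show n - 1 - (n - 1 - k) = k by omega] at h
  funext i
  rcases i with ⟨i, a⟩ | s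
  · exact congrFun ((annihilatorSeq_add A B ξ η i).symm.trans (h_zero _)) a
  · exact congrFun hξ s
end
end

section
/- Suppose (A,C) is observable and L ≥ n. Then the linear map that sends a pair (x_0, {u_k}_{k=0}^{L-1}) ∈ ℝ^n × (ℝ^m)^L to the corresponding input-output trajectory ({u_k}_{k=0}^{L-1}, {y_k}_{k=0}^{L-1}), where x_{k+1} = A x_k + B u_k and y_k = C x_k + D u_k, is injective. Consequently, the set of all input-output trajectories of length L of the LTI system is a linear subspace of ℝ^{(m+p)L} of dimension mL + n. -/
open Matrix

noncomputable section

/-- The state sequence of the system started at `x0` and driven by the input `u`. -/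
def stateOf (n m : ℕ) (A : Matrix (Fin n) (Fin n) ℝ) (B : Matrix (Fin n) (Fin m) ℝ)
    (x0 : Fin n → ℝ) (u : ℕ → Fin m → ℝ) : ℕ → Fin n → ℝ
  | 0 => x0
  | k + 1 => A.mulVec (stateOf n m A B x0 u k) + B.mulVec (u k)

/-- The observability matrix of an observable pair has trivial kernel. -/
theorem Observable.eq_zero {n p : ℕ} {A : Matrix (Fin n) (Fin n) ℝ}
    {C : Matrix (Fin p) (Fin n) ℝ} (h : Observable n p A C) {z : Fin n → ℝ}
    (hz : ∀ k < n, C *ᵥ (A ^ k *ᵥ z) = 0) : z = 0 := by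
  unfold Observable at h
  set M : Matrix (Fin n × Fin p) (Fin n) ℝ :=
    Matrix.of fun ki j => (C * A ^ (ki.1 : ℕ)) ki.2 j
  have hker : LinearMap.ker M.mulVecLin = ⊥ := by
    have hrank := M.mulVecLin.finrank_range_add_finrank_ker
    rw [Module.finrank_fin_fun] at hrank
    rw [Matrix.rank] at h
    exact Submodule.finrank_eq_zero.mp (by omega)
  refine (LinearMap.ker_eq_bot'.mp hker) z ?_
  ext ⟨k, b⟩
  have := congrFun (hz k k.2) b
  rwa [Matrix.mulVec_mulVec] at this

/-- The state sequence depends linearly on the initial state and the input. -/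
def stateLinearMap {n m : ℕ} (A : Matrix (Fin n) (Fin n) ℝ) (B : Matrix (Fin n) (Fin m) ℝ)
    (k : ℕ) : (Fin n → ℝ) × (ℕ → Fin m → ℝ) →ₗ[ℝ] (Fin n → ℝ) where
  toFun v := stateOf n m A B v.1 v.2 k
  map_add' v w := by
    induction k with
    | zero => rfl
    | succ k ih =>
      simp only [stateOf]
      rw [ih]
      simp only [Prod.snd_add, Pi.add_apply, Matrix.mulVec_add]
      abel
  map_smul' c v := by
    induction k with
    | zero => rfl
    | succ k ih =>
      simp only [stateOf]
      rw [ih]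
      simp only [Prod.smul_snd, Pi.smul_apply, Matrix.mulVec_smul, RingHom.id_apply, smul_add]

/-- A state sequence of the system is determined by its initial value and the input. -/
theorem eq_stateOf {n m L : ℕ} {A : Matrix (Fin n) (Fin n) ℝ} {B : Matrix (Fin n) (Fin m) ℝ}
    {x : ℕ → Fin n → ℝ} {u u' : ℕ → Fin m → ℝ} (hu : ∀ k < L, u k = u' k)
    (hx : ∀ k < L, x (k + 1) = A *ᵥ x k + B *ᵥ u k) {k : ℕ} (hk : k ≤ L) :
    x k = stateOf n m A B (x 0) u' k := by
  induction k with
  | zero => rfl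
  | succ k ih => rw [hx k hk, ih (by omega), hu k hk, stateOf]

/-- Under zero input the state evolves by powers of `A`. -/
theorem stateOf_zero_input {n m : ℕ} (A : Matrix (Fin n) (Fin n) ℝ)
    (B : Matrix (Fin n) (Fin m) ℝ) (x0 : Fin n → ℝ) (k : ℕ) :
    stateOf n m A B x0 0 k = A ^ k *ᵥ x0 := by
  induction k with
  | zero => simp [stateOf]
  | succ k ih => simp [stateOf, ih, pow_succ']

/-- Two initial states of an observable system that produce the same output under the same
input over at least `n` steps agree. -/
theorem Observable.initial_state_eq {n m p L : ℕ} {A : Matrix (Fin n) (Fin n) ℝ}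
    {B : Matrix (Fin n) (Fin m) ℝ} {C : Matrix (Fin p) (Fin n) ℝ}
    {D : Matrix (Fin p) (Fin m) ℝ} (hobs : Observable n p A C) (hL : n ≤ L)
    {x0 x0' : Fin n → ℝ} {u u' : ℕ → Fin m → ℝ} (hu : ∀ k < L, u k = u' k)
    (hy : ∀ k < L, C *ᵥ stateOf n m A B x0 u k + D *ᵥ u k =
      C *ᵥ stateOf n m A B x0' u' k + D *ᵥ u' k) : x0 = x0' := by
  refine sub_eq_zero.mp (hobs.eq_zero fun k hk => ?_)
  have hkL : k < L := hk.trans_le hL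
  have hstate : stateOf n m A B x0 u k = stateOf n m A B x0 u' k :=
    eq_stateOf (x := stateOf n m A B x0 u) hu (fun _ _ => rfl) hkL.le
  have hdiff := map_sub (stateLinearMap A B k) (x0, u') (x0', u')
  rw [Prod.mk_sub_mk, sub_self] at hdiff
  change stateOf n m A B (x0 - x0') 0 k =
    stateOf n m A B x0 u' k - stateOf n m A B x0' u' k at hdiff
  have hout := hy k hkL
  rw [hstate, hu k hkL] at hout
  rw [← stateOf_zero_input A B, hdiff, Matrix.mulVec_sub, sub_eq_zero]
  exact add_right_cancel hout

/-- Extension of a stacked finite signal by zero. -/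
def extendSignal (L m : ℕ) : (Fin L × Fin m → ℝ) →ₗ[ℝ] (ℕ → Fin m → ℝ) where
  toFun w k a := if h : k < L then w (⟨k, h⟩, a) else 0
  map_add' v w := by
    ext k a
    by_cases h : k < L <;> simp [h]
  map_smul' c w := by
    ext k a
    by_cases h : k < L <;> simp [h]

theorem extendSignal_apply_fin {L m : ℕ} (w : Fin L × Fin m → ℝ) (k : Fin L) (a : Fin m) :
    extendSignal L m w k a = w (k, a) := by
  simp [extendSignal]

/-- The linear map sending an initial state and an input to the stacked input-output
trajectory of length `L`. -/
def trajectoryMap {n m p : ℕ} (L : ℕ) (A : Matrix (Fin n) (Fin n) ℝ)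
    (B : Matrix (Fin n) (Fin m) ℝ) (C : Matrix (Fin p) (Fin n) ℝ)
    (D : Matrix (Fin p) (Fin m) ℝ) :
    (Fin n → ℝ) × (Fin L × Fin m → ℝ) →ₗ[ℝ] (Fin L × Fin m → ℝ) × (Fin L × Fin p → ℝ) :=
  (LinearMap.snd ℝ _ _).prod <| LinearMap.pi fun kb =>
    LinearMap.proj kb.2 ∘ₗ
      (C.mulVecLin ∘ₗ stateLinearMap A B kb.1 + D.mulVecLin ∘ₗ
        LinearMap.proj (kb.1 : ℕ) ∘ₗ LinearMap.snd ℝ _ _) ∘ₗ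
      LinearMap.prodMap LinearMap.id (extendSignal L m)

theorem trajectoryMap_snd_apply {n m p L : ℕ} (A : Matrix (Fin n) (Fin n) ℝ)
    (B : Matrix (Fin n) (Fin m) ℝ) (C : Matrix (Fin p) (Fin n) ℝ)
    (D : Matrix (Fin p) (Fin m) ℝ) (v : (Fin n → ℝ) × (Fin L × Fin m → ℝ))
    (k : Fin L) (b : Fin p) :
    (trajectoryMap L A B C D v).2 (k, b) =
      (C *ᵥ stateOf n m A B v.1 (extendSignal L m v.2) k + D *ᵥ extendSignal L m v.2 k) b :=
  rfl

theorem trajectoryMap_injective {n m p L : ℕ} {A : Matrix (Fin n) (Fin n) ℝ}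
    (B : Matrix (Fin n) (Fin m) ℝ) {C : Matrix (Fin p) (Fin n) ℝ}
    (D : Matrix (Fin p) (Fin m) ℝ) (hobs : Observable n p A C) (hL : n ≤ L) :
    Function.Injective (trajectoryMap L A B C D) := by
  rintro ⟨x0, w⟩ ⟨x0', w'⟩ h
  obtain rfl : w = w' := congrArg Prod.fst h
  have hx : x0 = x0' := by
    refine hobs.initial_state_eq (B := B) (D := D) (u := extendSignal L m w) hL
      (fun _ _ => rfl) fun k hk => ?_
    ext b
    exact congrFun (congrArg Prod.snd h) (⟨k, hk⟩, b)
  rw [hx]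

theorem coe_range_trajectoryMap {n m p L : ℕ} (A : Matrix (Fin n) (Fin n) ℝ)
    (B : Matrix (Fin n) (Fin m) ℝ) (C : Matrix (Fin p) (Fin n) ℝ)
    (D : Matrix (Fin p) (Fin m) ℝ) :
    (LinearMap.range (trajectoryMap L A B C D) :
        Set ((Fin L × Fin m → ℝ) × (Fin L × Fin p → ℝ))) =
      {w | ∃ (u : ℕ → Fin m → ℝ) (y : ℕ → Fin p → ℝ),
        IsTrajectory n m p L A B C D u y ∧
        (∀ (k : Fin L) (a : Fin m), w.1 (k, a) = u k a) ∧
        (∀ (k : Fin L) (b : Fin p), w.2 (k, b) = y k b)} := by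
  ext w
  constructor
  · rintro ⟨v, rfl⟩
    refine ⟨extendSignal L m v.2,
      fun k => C *ᵥ stateOf n m A B v.1 (extendSignal L m v.2) k + D *ᵥ extendSignal L m v.2 k,
      ⟨stateOf n m A B v.1 (extendSignal L m v.2), fun _ _ => ⟨rfl, rfl⟩⟩,
      fun k a => (extendSignal_apply_fin v.2 k a).symm, fun _ _ => rfl⟩
  · rintro ⟨u, y, ⟨x, hx⟩, hu, hy⟩
    have hext : ∀ k < L, u k = extendSignal L m w.1 k := fun k hk => by
      ext a
      rw [← hu ⟨k, hk⟩ a, ← extendSignal_apply_fin w.1 ⟨k, hk⟩ a]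
    refine ⟨(x 0, w.1), Prod.ext rfl ?_⟩
    ext ⟨k, b⟩
    rw [trajectoryMap_snd_apply, hy, (hx k k.2).2, hext k k.2,
      eq_stateOf hext (fun j hj => (hx j hj).1) k.2.le]

/-- If `(A,C)` is observable and `L ≥ n`, the linear map `(x_0, u) ↦ (u, y)` is
injective, and the set of all stacked input-output trajectories of length `L` is a
linear subspace of `ℝ^{(m+p)L}` of dimension `mL + n`. -/
theorem trajectory_map_injective_and_dim (n m p L : ℕ)
    (A : Matrix (Fin n) (Fin n) ℝ) (B : Matrix (Fin n) (Fin m) ℝ)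
    (C : Matrix (Fin p) (Fin n) ℝ) (D : Matrix (Fin p) (Fin m) ℝ)
    (hobs : Observable n p A C) (hL : n ≤ L) :
    (∀ (x0 x0' : Fin n → ℝ) (u u' : ℕ → Fin m → ℝ),
      (∀ k < L, u k = u' k) →
      (∀ k < L,
        C.mulVec (stateOf n m A B x0 u k) + D.mulVec (u k) =
        C.mulVec (stateOf n m A B x0' u' k) + D.mulVec (u' k)) →
      x0 = x0' ∧ ∀ k < L, u k = u' k) ∧
    ∃ S : Submodule ℝ ((Fin L × Fin m → ℝ) × (Fin L × Fin p → ℝ)),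
      (S : Set ((Fin L × Fin m → ℝ) × (Fin L × Fin p → ℝ))) =
        {w | ∃ (u : ℕ → Fin m → ℝ) (y : ℕ → Fin p → ℝ),
          IsTrajectory n m p L A B C D u y ∧
          (∀ (k : Fin L) (a : Fin m), w.1 (k, a) = u k a) ∧
          (∀ (k : Fin L) (b : Fin p), w.2 (k, b) = y k b)} ∧
      Module.finrank ℝ S = m * L + n := by
  refine ⟨fun x0 x0' u u' hu hy => ⟨hobs.initial_state_eq hL hu hy, hu⟩,
    LinearMap.range (trajectoryMap L A B C D), coe_range_trajectoryMap A B C D, ?_⟩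
  rw [LinearMap.finrank_range_of_inj (trajectoryMap_injective B D hobs hL), Module.finrank_prod,
    Module.finrank_fin_fun, Module.finrank_fintype_fun_eq_card, Fintype.card_prod,
    Fintype.card_fin, Fintype.card_fin, mul_comm L m, add_comm]
end
end

section
/- Suppose (A,C) is observable and the constant input-output sequence {u_k, y_k}_{k=0}^{n} with (u_k, y_k) = (u^s, y^s) for all k ∈ {0,…,n} (length n+1) is a trajectory of the LTI system. Then there exists a unique x^s ∈ ℝ^n with x^s = A x^s + B u^s and y^s = C x^s + D u^s. -/
open Matrix

noncomputable section

theorem Observable.eq_zero_of_mulVec_pow_eq_zero {n p : ℕ} {A : Matrix (Fin n) (Fin n) ℝ}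
    {C : Matrix (Fin p) (Fin n) ℝ} (hobs : Observable n p A C) {v : Fin n → ℝ}
    (hv : ∀ k < n, C *ᵥ (A ^ k *ᵥ v) = 0) : v = 0 := by
  unfold Observable at hobs
  set M : Matrix (Fin n × Fin p) (Fin n) ℝ :=
    Matrix.of fun ki j => (C * A ^ (ki.1 : ℕ)) ki.2 j
  have hker : Module.finrank ℝ (LinearMap.ker M.mulVecLin) = 0 := by
    have h := LinearMap.finrank_range_add_finrank_ker M.mulVecLin
    rw [Module.finrank_fin_fun] at h
    change M.rank + _ = n at h
    omega
  have hbot : LinearMap.ker M.mulVecLin = ⊥ := Submodule.finrank_eq_zero.mp hker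
  have hmem : v ∈ LinearMap.ker M.mulVecLin := by
    rw [LinearMap.mem_ker, mulVecLin_apply]
    ext ⟨k, i⟩
    have h := congrFun (hv k k.isLt) i
    rw [mulVec_mulVec] at h
    exact h
  rw [hbot] at hmem
  exact (Submodule.mem_bot ℝ).mp hmem

/-- For an observable system, an input-output equilibrium `(u^s, y^s)` corresponds to a
unique steady state `x^s`. -/
theorem equilibrium_unique_steady_state (n m p : ℕ)
    (A : Matrix (Fin n) (Fin n) ℝ) (B : Matrix (Fin n) (Fin m) ℝ)
    (C : Matrix (Fin p) (Fin n) ℝ) (D : Matrix (Fin p) (Fin m) ℝ)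
    (hobs : Observable n p A C)
    (us : Fin m → ℝ) (ys : Fin p → ℝ)
    (heq : IsTrajectory n m p (n + 1) A B C D (fun _ => us) (fun _ => ys)) :
    ∃! xs : Fin n → ℝ,
      xs = A.mulVec xs + B.mulVec us ∧ ys = C.mulVec xs + D.mulVec us := by
  have hC : ∀ {v w : Fin n → ℝ}, ys = C *ᵥ v + D *ᵥ us → ys = C *ᵥ w + D *ᵥ us →
      C *ᵥ (v - w) = 0 := by
    intro v w hv hw
    rw [mulVec_sub, sub_eq_zero]
    exact add_right_cancel (hv.symm.trans hw)
  obtain ⟨x, hx⟩ := heq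
  have hstep : ∀ k ≤ n, A ^ k *ᵥ (x 1 - x 0) = x (k + 1) - x k := by
    intro k
    induction k with
    | zero => simp
    | succ k ih =>
      intro hk
      rw [pow_succ', ← mulVec_mulVec, ih (by omega), (hx (k + 1) (by omega)).1]
      nth_rewrite 3 [(hx k (by omega)).1]
      rw [mulVec_sub, add_sub_add_right_eq_sub]
  have hfix : x 1 - x 0 = 0 := hobs.eq_zero_of_mulVec_pow_eq_zero fun k hk => by
    rw [hstep k hk.le]
    exact hC (hx (k + 1) (by omega)).2 (hx k (by omega)).2
  obtain ⟨hx1, hy0⟩ := hx 0 n.succ_pos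
  refine ⟨x 0, ⟨(sub_eq_zero.mp hfix).symm.trans hx1, hy0⟩, ?_⟩
  rintro z ⟨hz, hyz⟩
  have hz0 : A *ᵥ (z - x 0) = z - x 0 := by
    have h0 : x 0 = A *ᵥ x 0 + B *ᵥ us := (sub_eq_zero.mp hfix).symm.trans hx1
    rw [mulVec_sub, ← add_sub_add_right_eq_sub _ _ (B *ᵥ us), ← hz, ← h0]
  have hpow : ∀ k, A ^ k *ᵥ (z - x 0) = z - x 0 := by
    intro k
    induction k with
    | zero => simp
    | succ k ih => rw [pow_succ', ← mulVec_mulVec, ih, hz0]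
  refine sub_eq_zero.mp (hobs.eq_zero_of_mulVec_pow_eq_zero fun k _ => ?_)
  rw [hpow k]
  exact hC hyz hy0
end
end

section
/- Suppose (A,C) is observable, L ≥ n, x^s ∈ ℝ^n satisfies x^s = A x^s + B u^s and y^s = C x^s + D u^s, and {u_k, y_k}_{k=0}^{L-1} is a trajectory of the LTI system with (u_k, y_k) = (u^s, y^s) for all k ∈ {L−n, …, L−1}. Then the extended sequence {u_k, y_k}_{k=0}^{L} obtained by appending (u_L, y_L) = (u^s, y^s) is also a trajectory of the LTI system. -/
open Matrix

noncomputable section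

/-- A state of an observable system that produces `n` zero outputs is zero. -/
lemma Observable.eq_zero_s14 {n p : ℕ} {A : Matrix (Fin n) (Fin n) ℝ}
    {C : Matrix (Fin p) (Fin n) ℝ} (hobs : Observable n p A C) {e : Fin n → ℝ}
    (he : ∀ i < n, C.mulVec ((A ^ i).mulVec e) = 0) : e = 0 := by
  set O : Matrix (Fin n × Fin p) (Fin n) ℝ :=
    Matrix.of fun ki j => (C * A ^ (ki.1 : ℕ)) ki.2 j
  have hrank : Module.finrank ℝ (LinearMap.range O.mulVecLin) = n := hobs
  have hsum := O.mulVecLin.finrank_range_add_finrank_ker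
  rw [hrank, Module.finrank_fin_fun] at hsum
  have hker : LinearMap.ker O.mulVecLin = ⊥ :=
    Submodule.finrank_eq_zero.mp (by omega)
  refine LinearMap.ker_eq_bot'.mp hker e (funext fun ki => ?_)
  have h := congrFun (he ki.1 ki.1.isLt) ki.2
  rw [Matrix.mulVec_mulVec] at h
  exact h

/-- A state sequence of the autonomous system `e (k + 1) = A e k` is given by powers of `A`. -/
lemma eq_pow_mulVec_of_step {n N : ℕ} {A : Matrix (Fin n) (Fin n) ℝ} {e : ℕ → Fin n → ℝ}
    (he : ∀ k < N, e (k + 1) = A.mulVec (e k)) : ∀ k ≤ N, e k = (A ^ k).mulVec (e 0) := by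
  intro k hk
  induction k with
  | zero => simp
  | succ k ih => rw [he k hk, ih (by omega), Matrix.mulVec_mulVec, ← pow_succ']

/-- If the output of an observable system stays at an equilibrium for `n` steps under the
equilibrium input, then the final state is the equilibrium state. -/
lemma Observable.eq_equilibrium {n m p : ℕ} {A : Matrix (Fin n) (Fin n) ℝ}
    {B : Matrix (Fin n) (Fin m) ℝ} {C : Matrix (Fin p) (Fin n) ℝ}
    {D : Matrix (Fin p) (Fin m) ℝ} (hobs : Observable n p A C)
    {us : Fin m → ℝ} {ys : Fin p → ℝ} {xs : Fin n → ℝ}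
    (hxs : xs = A.mulVec xs + B.mulVec us) (hys : ys = C.mulVec xs + D.mulVec us)
    {x : ℕ → Fin n → ℝ}
    (hx : ∀ k < n, x (k + 1) = A.mulVec (x k) + B.mulVec us ∧
      ys = C.mulVec (x k) + D.mulVec us) : x n = xs := by
  have hpow := eq_pow_mulVec_of_step (N := n) (A := A) (e := fun k => x k - xs) fun k hk => by
    rw [Matrix.mulVec_sub, (hx k hk).1]
    nth_rewrite 1 [hxs]
    abel
  have hzero : x 0 - xs = 0 := hobs.eq_zero_s14 fun i hi => by
    rw [← hpow i hi.le, Matrix.mulVec_sub, sub_eq_zero]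
    exact add_right_cancel ((hx i hi).2.symm.trans hys)
  have h := hpow n le_rfl
  rw [hzero, Matrix.mulVec_zero] at h
  exact sub_eq_zero.mp h

/-- If a trajectory of an observable system ends with `n` steps at the equilibrium
`(u^s, y^s)`, then appending `(u^s, y^s)` again yields a trajectory. -/
theorem append_equilibrium_step (n m p L : ℕ)
    (A : Matrix (Fin n) (Fin n) ℝ) (B : Matrix (Fin n) (Fin m) ℝ)
    (C : Matrix (Fin p) (Fin n) ℝ) (D : Matrix (Fin p) (Fin m) ℝ)
    (hobs : Observable n p A C) (hL : n ≤ L)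
    (us : Fin m → ℝ) (ys : Fin p → ℝ) (xs : Fin n → ℝ)
    (hxs : xs = A.mulVec xs + B.mulVec us)
    (hys : ys = C.mulVec xs + D.mulVec us)
    (u : ℕ → Fin m → ℝ) (y : ℕ → Fin p → ℝ)
    (hT : IsTrajectory n m p L A B C D u y)
    (hterm : ∀ k, L - n ≤ k → k < L → u k = us ∧ y k = ys)
    (huL : u L = us) (hyL : y L = ys) :
    IsTrajectory n m p (L + 1) A B C D u y := by
  obtain ⟨x, hx⟩ := hT
  have hxL : x L = xs := by
    have h := hobs.eq_equilibrium hxs hys (x := fun k => x (L - n + k)) fun k hk => by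
      obtain ⟨hu, hy⟩ := hterm (L - n + k) (by omega) (by omega)
      have h := hx (L - n + k) (by omega)
      rw [hu, hy] at h
      exact h
    rwa [Nat.sub_add_cancel hL] at h
  refine ⟨fun k => if k ≤ L then x k else xs, fun k hk => ?_⟩
  rcases Nat.lt_succ_iff_lt_or_eq.mp hk with hk | rfl
  · simpa [hk.le, Nat.succ_le_of_lt hk] using hx k hk
  · simp only [le_refl, if_true, Nat.not_succ_le_self, if_false, huL, hyL, hxL]
    exact ⟨hxs, hys⟩
end
end

section
/- Consider a discrete-time affine system x_{k+1} = A x_k + B u_k + e, y_k = C x_k + D u_k + r with constant offsets e ∈ ℝ^n, r ∈ ℝ^p. Let {u_k^d, y_k^d}_{k=0}^{N-1} be a trajectory of this affine system and let 1 ≤ L ≤ N. If α ∈ ℝ^{N−L+1} satisfies ∑_{i=0}^{N−L} α_i = 1, then the sequence {ū_k, ȳ_k}_{k=0}^{L-1} defined (in stacked form) by ū = H_L(u^d)α and ȳ = H_L(y^d)α is a trajectory of the same affine system; i.e., the constant offset is carried through from the measured data to the predictions. -/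
open Matrix

noncomputable section

/-- `{u_k, y_k}_{k=0}^{L-1}` is a trajectory of the affine system
`x⁺ = Ax + Bu + e`, `y = Cx + Du + r`. -/
def IsAffineTrajectory (n m p L : ℕ) (A : Matrix (Fin n) (Fin n) ℝ)
    (B : Matrix (Fin n) (Fin m) ℝ) (C : Matrix (Fin p) (Fin n) ℝ)
    (D : Matrix (Fin p) (Fin m) ℝ) (e : Fin n → ℝ) (r : Fin p → ℝ)
    (u : ℕ → Fin m → ℝ) (y : ℕ → Fin p → ℝ) : Prop :=
  ∃ x : ℕ → Fin n → ℝ, ∀ k < L,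
    x (k + 1) = A.mulVec (x k) + B.mulVec (u k) + e ∧
    y k = C.mulVec (x k) + D.mulVec (u k) + r

theorem hankel_mulVec_eq_sum (m N L : ℕ) (u : ℕ → Fin m → ℝ) (α : Fin (N - L + 1) → ℝ)
    (k : Fin L) (a : Fin m) :
    (Hankel m N L u).mulVec α (k, a) = (∑ j, α j • u (k + j)) a := by
  simp [Hankel, Matrix.mulVec, dotProduct, mul_comm]

/-- An affine map of two vectors commutes with combinations whose weights sum to one. -/
theorem sum_smul_mulVec_add_mulVec_add {ι l n m : Type*} [Fintype ι] [Fintype n] [Fintype m]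
    (A : Matrix l n ℝ) (B : Matrix l m ℝ) (e : l → ℝ) (α : ι → ℝ) (hα : ∑ i, α i = 1)
    (x : ι → n → ℝ) (u : ι → m → ℝ) :
    ∑ i, α i • (A.mulVec (x i) + B.mulVec (u i) + e) =
      A.mulVec (∑ i, α i • x i) + B.mulVec (∑ i, α i • u i) + e := by
  simp only [smul_add, Finset.sum_add_distrib, ← Finset.sum_smul, hα, one_smul,
    Matrix.mulVec_sum, Matrix.mulVec_smul]

/-- For an affine system, a linear combination of the columns of the stacked Hankel
matrices of measured data whose coefficients sum to one is again a trajectory of the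
same affine system: the constant offset carries through to the predictions. -/
theorem affine_hankel_combination (n m p N L : ℕ)
    (A : Matrix (Fin n) (Fin n) ℝ) (B : Matrix (Fin n) (Fin m) ℝ)
    (C : Matrix (Fin p) (Fin n) ℝ) (D : Matrix (Fin p) (Fin m) ℝ)
    (e : Fin n → ℝ) (r : Fin p → ℝ)
    (ud : ℕ → Fin m → ℝ) (yd : ℕ → Fin p → ℝ)
    (hT : IsAffineTrajectory n m p N A B C D e r ud yd)
    (hL1 : 1 ≤ L) (hLN : L ≤ N)
    (α : Fin (N - L + 1) → ℝ) (hα : ∑ i, α i = 1)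
    (ub : ℕ → Fin m → ℝ) (yb : ℕ → Fin p → ℝ)
    (hub : ∀ (k : Fin L) (a : Fin m), ub k a = (Hankel m N L ud).mulVec α (k, a))
    (hyb : ∀ (k : Fin L) (b : Fin p), yb k b = (Hankel p N L yd).mulVec α (k, b)) :
    IsAffineTrajectory n m p L A B C D e r ub yb := by
  obtain ⟨x, hx⟩ := hT
  refine ⟨fun k => ∑ j, α j • x (k + j), fun k hk => ?_⟩
  have hu : ub k = ∑ j, α j • ud (k + j) :=
    funext fun a => (hub ⟨k, hk⟩ a).trans (hankel_mulVec_eq_sum m N L ud α ⟨k, hk⟩ a)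
  have hy : yb k = ∑ j, α j • yd (k + j) :=
    funext fun b => (hyb ⟨k, hk⟩ b).trans (hankel_mulVec_eq_sum p N L yd α ⟨k, hk⟩ b)
  have hkj (j : Fin (N - L + 1)) : k + j < N := by omega
  rw [hu, hy, ← sum_smul_mulVec_add_mulVec_add A B e α hα,
    ← sum_smul_mulVec_add_mulVec_add C D r α hα]
  refine ⟨Finset.sum_congr rfl fun j _ => ?_, Finset.sum_congr rfl fun j _ => ?_⟩
  · rw [← (hx _ (hkj j)).1, add_right_comm]
  · rw [← (hx _ (hkj j)).2]
end
end
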